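/- Let φ be a function of class C⁷ on a neighborhood of the origin in ℝ² of the form φ(x₁,x₂) = b(x₁,x₂)·x₂³ + x₂·x₁³·b₁(x₁) + x₁⁶·b₀(x₁), where b, b₁, b₀ are functions of class C¹ with b(0,0) ≠ 0 and b₁(0) ≠ 0. Then there exist a C¹ function φ̂ defined on a sufficiently small neighborhood of 0 in ℝ and C¹ functions B and B₁ defined on a neighborhood of the origin in ℝ² with B(0,0) ≠ 0 and B₁(0,0) ≠ 0, such that for all (x₁,x₂) in a neighborhood of the origin: φ(x₁, x₂ + x₁³·φ̂(x₁)) = B(x₁,x₂)·x₂³ + x₂·x₁³·B₁(x₁,x₂). -/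

import Mathlib

open Set Filter Topology MeasureTheory

lemma ContDiff.parametric_intervalIntegral {P : Type*} [NormedAddCommGroup P] [NormedSpace ℝ P]
    {n : ℕ∞} {F : P × ℝ → ℝ} (hF : ContDiff ℝ n F) :
    ContDiff ℝ n fun p => ∫ t in (0 : ℝ)..1, F (p, t) := by
  let χ : ContDiffBump (0 : ℝ) := ⟨1, 2, one_pos, one_lt_two⟩
  have key := contDiffOn_convolution_right_with_param_comp (μ := volume) (n := n)
    (ContinuousLinearMap.mul ℝ ℝ) (s := (univ : Set P)) (v := fun _ => (0 : ℝ))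
    contDiffOn_const (f := (Ioc (0 : ℝ) 1).indicator 1)
    (g := fun p u => χ u * F (p, -u)) (k := Metric.closedBall 0 2) isOpen_univ
    (isCompact_closedBall _ _)
    (fun p x _ hx => by
      rw [χ.zero_of_le_dist (le_of_not_ge hx), zero_mul])
    (Integrable.locallyIntegrable <| by
      rw [integrable_indicator_iff measurableSet_Ioc]
      exact integrableOn_const (C := (1 : ℝ)) (by simp))
    (by
      refine ContDiff.contDiffOn ?_
      exact (χ.contDiff.comp contDiff_snd).mul
        (hF.comp (contDiff_fst.prodMk contDiff_snd.neg)))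
  rw [contDiffOn_univ] at key
  convert key using 2 with p
  rw [intervalIntegral.integral_of_le zero_le_one, ← integral_indicator measurableSet_Ioc, convolution]
  congr 1 with t
  by_cases ht : t ∈ Ioc (0 : ℝ) 1
  · have : χ (-t) = 1 := χ.one_of_mem_closedBall (by
      simpa [χ, abs_le] using ⟨by linarith [ht.1], ht.2⟩)
    simp [ht, this]
  · simp [ht]

lemma ContDiff.exists_sub_eq_mul {n : ℕ} {f : ℝ × ℝ → ℝ} (hf : ContDiff ℝ (n + 1) f) :
    ∃ g : ℝ × ℝ × ℝ → ℝ, ContDiff ℝ n g ∧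
      ∀ x u v, f (x, v) - f (x, u) = (v - u) * g (x, u, v) := by
  have hf1 : Differentiable ℝ f := hf.differentiable (by simp)
  have hf' : ContDiff ℝ n (fderiv ℝ f) := hf.fderiv_right le_rfl
  refine ⟨fun p => ∫ t in (0 : ℝ)..1, fderiv ℝ f (p.1, p.2.1 + t * (p.2.2 - p.2.1)) (0, 1), ?_, ?_⟩
  · refine ContDiff.parametric_intervalIntegral (n := (n : ℕ∞)) (F := fun q : (ℝ × ℝ × ℝ) × ℝ =>
      fderiv ℝ f (q.1.1, q.1.2.1 + q.2 * (q.1.2.2 - q.1.2.1)) (0, 1)) ?_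
    refine ContDiff.clm_apply (hf'.comp ?_) contDiff_const
    fun_prop
  · intro x u v
    have h (t : ℝ) : HasDerivAt (fun t => f (x, u + t * (v - u)))
        ((v - u) * fderiv ℝ f (x, u + t * (v - u)) (0, 1)) t := by
      have h1 : HasDerivAt (fun t : ℝ => (x, u + t * (v - u))) (0, v - u) t :=
        (hasDerivAt_const t x).prodMk <| by
          simpa using ((hasDerivAt_id t).mul_const (v - u)).const_add u
      have h2 := (hf1 (x, u + t * (v - u))).hasFDerivAt.comp_hasDerivAt t h1
      have h3 : ((0 : ℝ), v - u) = (v - u) • ((0 : ℝ), (1 : ℝ)) := by simp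
      rwa [h3, map_smul, smul_eq_mul] at h2
    have hc : Continuous fun t : ℝ => (v - u) * fderiv ℝ f (x, u + t * (v - u)) (0, 1) := by
      have := hf'.continuous
      fun_prop
    have := intervalIntegral.integral_eq_sub_of_hasDerivAt (fun t _ => h t) (hc.intervalIntegrable 0 1)
    simp only [intervalIntegral.integral_const_mul] at this
    rw [this]
    simp

lemma eq_of_eventually_mul_eq {f g : ℝ → ℝ} (hf : ContinuousAt f 0) (hg : ContinuousAt g 0)
    (h : ∀ᶠ v in 𝓝 0, v * f v = v * g v) : f 0 = g 0 := by
  refine ((hf.eventuallyEq_nhds_iff_eventuallyEq_nhdsNE hg).1 ?_).eq_of_nhds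
  filter_upwards [h.filter_mono nhdsWithin_le_nhds, self_mem_nhdsWithin] with v hv hv0
  exact mul_left_cancel₀ hv0 hv

/-- A continuous coefficient of `x₂³` in a function of class `Cⁿ⁺³` is of class `Cⁿ`. -/
lemma exists_contDiff_eventuallyEq_coeff {n : ℕ} {φ b : ℝ × ℝ → ℝ} {c d : ℝ → ℝ}
    (hφ : ContDiff ℝ (n + 3) φ) (hb : ∀ᶠ x in 𝓝 (0 : ℝ × ℝ), ContinuousAt b x)
    (hform : ∀ᶠ x in 𝓝 (0 : ℝ × ℝ), φ x = b x * x.2 ^ 3 + x.2 * c x.1 + d x.1) :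
    ∃ k : ℝ × ℝ → ℝ, ContDiff ℝ n k ∧ k =ᶠ[𝓝 0] b := by
  obtain ⟨g, hg, hφg⟩ := ContDiff.exists_sub_eq_mul (n := n + 2) (f := φ)
    (by convert hφ using 1; push_cast; rw [add_assoc]; norm_num)
  let g' : ℝ × ℝ → ℝ := fun x => g (x.1, 0, x.2)
  have hg' : ContDiff ℝ ((n + 1 : ℕ) + 1) g' := by
    have : ContDiff ℝ ((n + 1 : ℕ) + 1) g := by
      convert hg using 1; push_cast; rw [add_assoc]; norm_num
    exact this.comp (by fun_prop)
  obtain ⟨h, hh, hgh⟩ := hg'.exists_sub_eq_mul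
  let h' : ℝ × ℝ → ℝ := fun x => h (x.1, 0, x.2)
  have hh' : ContDiff ℝ (n + 1) h' := by
    have : ContDiff ℝ (n + 1) h := by exact_mod_cast hh
    exact this.comp (by fun_prop)
  obtain ⟨k, hk, hhk⟩ := hh'.exists_sub_eq_mul
  let k' : ℝ × ℝ → ℝ := fun x => k (x.1, 0, x.2)
  have hk' : ContDiff ℝ n k' := hk.comp (by fun_prop)
  refine ⟨k', hk', ?_⟩
  obtain ⟨r, hr, hball⟩ := Metric.eventually_nhds_iff_ball.1 (hb.and hform)
  have hcg := hg'.continuous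
  have hch := hh'.continuous
  have hck := hk'.continuous
  have hmem (x v : ℝ) : (x, v) ∈ Metric.ball (0 : ℝ × ℝ) r ↔ |x| < r ∧ |v| < r := by
    simp [Prod.norm_def]
  filter_upwards [Metric.ball_mem_nhds 0 hr] with ⟨x, v⟩ hxv
  obtain ⟨hx, hv⟩ := (hmem x v).1 hxv
  have hV : ∀ᶠ v : ℝ in 𝓝 0, |v| < r := by
    filter_upwards [Metric.ball_mem_nhds (0 : ℝ) hr] with v hv
    simpa using hv
  have hbx : ContinuousAt (fun v => b (x, v)) 0 :=
    (hball (x, 0) ((hmem _ _).2 ⟨hx, by simpa using hr⟩)).1.comp (by fun_prop)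
  have eφ (v) (hv : |v| < r) : v * g' (x, v) = v * (b (x, v) * v ^ 2 + c x) := by
    have h1 := (hball (x, v) ((hmem _ _).2 ⟨hx, hv⟩)).2
    have h2 := (hball (x, 0) ((hmem _ _).2 ⟨hx, by simpa using hr⟩)).2
    have h3 := hφg x 0 v
    simp only at h1 h2
    simp only [g']
    linear_combination h1 - h2 - h3
  have e1 : g' (x, 0) = c x := by
    simpa using eq_of_eventually_mul_eq (f := fun v => g' (x, v))
      (g := fun v => b (x, v) * v ^ 2 + c x) (by fun_prop)
      ((hbx.mul (by fun_prop)).add continuousAt_const) (hV.mono eφ)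
  have eg (v) (hv : |v| < r) : v * h' (x, v) = v * (b (x, v) * v) := by
    have h3 := hgh x 0 v
    rcases eq_or_ne v 0 with rfl | h0
    · simp
    · have h4 := mul_left_cancel₀ h0 (eφ v hv)
      simp only [h']
      linear_combination h4 - h3 - e1
  have e2 : h' (x, 0) = 0 := by
    simpa using eq_of_eventually_mul_eq (f := fun v => h' (x, v))
      (g := fun v => b (x, v) * v) (by fun_prop) (hbx.mul continuousAt_id) (hV.mono eg)
  have eh (v) (hv : |v| < r) : v * k' (x, v) = v * b (x, v) := by
    have h3 := hhk x 0 v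
    rcases eq_or_ne v 0 with rfl | h0
    · simp
    · have h4 := mul_left_cancel₀ h0 (eg v hv)
      simp only [k']
      linear_combination h4 - h3 - e2
  rcases eq_or_ne v 0 with rfl | h0
  · exact eq_of_eventually_mul_eq (f := fun v => k' (x, v)) (by fun_prop) hbx (hV.mono eh)
  · exact mul_left_cancel₀ h0 (eh v hv)

lemma ContDiffOn.exists_contDiff_eventuallyEq {E : Type*} [NormedAddCommGroup E] [NormedSpace ℝ E]
    [FiniteDimensional ℝ E] {n : ℕ} {f : E → ℝ} {x : E} {s : Set E} (hs : s ∈ 𝓝 x)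
    (hf : ContDiffOn ℝ n f s) : ∃ g : E → ℝ, ContDiff ℝ n g ∧ g =ᶠ[𝓝 x] f := by
  obtain ⟨r, hr, hrs⟩ := Metric.mem_nhds_iff.1 hs
  let χ : ContDiffBump x := ⟨r / 4, r / 2, by positivity, by linarith⟩
  refine ⟨fun y => χ y * f y, ?_, ?_⟩
  · rw [contDiff_iff_contDiffAt]
    intro y
    by_cases hy : y ∈ Metric.ball x r
    · exact χ.contDiffAt.mul (hf.contDiffAt (mem_of_superset (Metric.isOpen_ball.mem_nhds hy) hrs))
    · have : (fun y => χ y * f y) =ᶠ[𝓝 y] fun _ => 0 := by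
        have : (Metric.closedBall x (r / 2))ᶜ ∈ 𝓝 y :=
          Metric.isClosed_closedBall.isOpen_compl.mem_nhds fun h =>
            hy (Metric.closedBall_subset_ball (by linarith) h)
        filter_upwards [this] with z hz
        rw [χ.zero_of_le_dist (le_of_not_ge hz), zero_mul]
      exact contDiffAt_const.congr_of_eventuallyEq this
  · filter_upwards [χ.eventuallyEq_one] with y hy
    simp [hy]

/-- The rescaled equation `φ(x, x³ψ) = 0` has a root of class `C¹`. -/
lemma exists_contDiffAt_root {k : ℝ × ℝ → ℝ} {b₁ b₀ : ℝ → ℝ} (hk : ContDiff ℝ 1 k)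
    (hb₁ : ContDiffAt ℝ 1 b₁ 0) (hb₀ : ContDiffAt ℝ 1 b₀ 0) (h0 : b₁ 0 ≠ 0) :
    ∃ ψ : ℝ → ℝ, ContDiffAt ℝ 1 ψ 0 ∧
      ∀ᶠ x in 𝓝 0, k (x, x ^ 3 * ψ x) * x ^ 3 * ψ x ^ 3 + ψ x * b₁ x + b₀ x = 0 := by
  let G : ℝ × ℝ → ℝ := fun p =>
    k (p.1, p.1 ^ 3 * p.2) * p.1 ^ 3 * p.2 ^ 3 + p.2 * b₁ p.1 + b₀ p.1
  let u : ℝ × ℝ := (0, -b₀ 0 / b₁ 0)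
  have hG : ContDiffAt ℝ 1 G u := by
    have h1 : ContDiffAt ℝ 1 (fun p : ℝ × ℝ => b₁ p.1) u :=
      ContDiffAt.comp (f := Prod.fst) u hb₁ contDiffAt_fst
    have h2 : ContDiffAt ℝ 1 (fun p : ℝ × ℝ => b₀ p.1) u :=
      ContDiffAt.comp (f := Prod.fst) u hb₀ contDiffAt_fst
    have h3 : ContDiffAt ℝ 1 (fun p : ℝ × ℝ => k (p.1, p.1 ^ 3 * p.2)) u :=
      hk.contDiffAt.comp u (by fun_prop)
    fun_prop
  have hinv : (fderiv ℝ G u ∘L .inr ℝ ℝ ℝ).IsInvertible := by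
    refine ⟨ContinuousLinearEquiv.unitsEquivAut ℝ (Units.mk0 (b₁ 0) h0), ?_⟩
    have h1 : HasFDerivAt (fun t : ℝ => G (0, t)) (fderiv ℝ G u ∘L .inr ℝ ℝ ℝ) u.2 :=
      (hG.differentiableAt one_ne_zero).hasFDerivAt.comp u.2 (hasFDerivAt_prodMk_right _ _)
    have h2 : HasDerivAt (fun t : ℝ => G (0, t)) (b₁ 0) u.2 := by
      simpa [G] using ((hasDerivAt_id u.2).mul_const (b₁ 0)).add_const (b₀ 0)
    rw [h1.unique h2.hasFDerivAt]
    ext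
    simp
  refine ⟨hG.implicitFunction one_ne_zero hinv, hG.contDiffAt_implicitFunction one_ne_zero hinv, ?_⟩
  have hu : G u = 0 := by
    simp only [G, u]
    field_simp
    ring
  simpa only [hu] using hG.eventually_apply_implicitFunction one_ne_zero hinv

/-- if a `C⁷` function near the origin has the form
`φ(x₁,x₂) = b(x₁,x₂)·x₂³ + x₂·x₁³·b₁(x₁) + x₁⁶·b₀(x₁)` with `b, b₁, b₀` of class `C¹`,
`b(0,0) ≠ 0` and `b₁(0) ≠ 0`, then there is a `C¹` function `φ̂` near `0 ∈ ℝ` and `C¹`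
functions `B, B₁` near the origin with `B(0,0) ≠ 0`, `B₁(0,0) ≠ 0` such that
`φ(x₁, x₂ + x₁³·φ̂(x₁)) = B(x₁,x₂)·x₂³ + x₂·x₁³·B₁(x₁,x₂)` near the origin. -/
theorem stmt_5 (U : Set (ℝ × ℝ)) (hU : U ∈ nhds (0 : ℝ × ℝ))
    (φ : ℝ × ℝ → ℝ) (hφ : ContDiffOn ℝ 7 φ U)
    (b : ℝ × ℝ → ℝ) (b₁ b₀ : ℝ → ℝ)
    (hb : ContDiffOn ℝ 1 b U)
    (hb₁ : ContDiffOn ℝ 1 b₁ ((fun x : ℝ × ℝ => x.1) '' U))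
    (hb₀ : ContDiffOn ℝ 1 b₀ ((fun x : ℝ × ℝ => x.1) '' U))
    (hb0 : b (0, 0) ≠ 0) (hb₁0 : b₁ 0 ≠ 0)
    (hform : ∀ x ∈ U, φ x = b x * x.2 ^ 3 + x.2 * x.1 ^ 3 * b₁ x.1 + x.1 ^ 6 * b₀ x.1) :
    ∃ δ : ℝ, 0 < δ ∧ ∃ φhat : ℝ → ℝ, ContDiffOn ℝ 1 φhat (Ioo (-δ) δ) ∧
      ∃ B B₁ : ℝ × ℝ → ℝ, ∃ W ∈ nhds (0 : ℝ × ℝ),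
        ContDiffOn ℝ 1 B W ∧ ContDiffOn ℝ 1 B₁ W ∧
        B (0, 0) ≠ 0 ∧ B₁ (0, 0) ≠ 0 ∧
        ∀ x ∈ W, φ (x.1, x.2 + x.1 ^ 3 * φhat x.1) =
          B x * x.2 ^ 3 + x.2 * x.1 ^ 3 * B₁ x := by
  obtain ⟨Φ, hΦ, hΦφ⟩ := ContDiffOn.exists_contDiff_eventuallyEq (n := 7) hU (by exact_mod_cast hφ)
  have hU1 := isOpenMap_fst.image_mem_nhds hU
  obtain ⟨k, hk, hkb⟩ := exists_contDiff_eventuallyEq_coeff (n := 4) (φ := Φ) (b := b)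
    (c := fun x => x ^ 3 * b₁ x) (d := fun x => x ^ 6 * b₀ x)
    (by convert hΦ using 1; norm_num)
    (by
      filter_upwards [eventually_mem_nhds_iff.2 hU] with x hx
      exact (hb.continuousOn).continuousAt hx)
    (by
      filter_upwards [hU, hΦφ] with x hx hx'
      rw [hx', hform x hx]
      ring)
  have hφk : ∀ᶠ x in 𝓝 (0 : ℝ × ℝ),
      φ x = k x * x.2 ^ 3 + x.2 * x.1 ^ 3 * b₁ x.1 + x.1 ^ 6 * b₀ x.1 := by
    filter_upwards [hU, hkb] with x hx hx'
    rw [hx', hform x hx]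
  have hk0 : k (0, 0) ≠ 0 := by
    rw [show k (0, 0) = b (0, 0) from hkb.eq_of_nhds]
    exact hb0
  have hk1 : ContDiff ℝ 1 k := hk.of_le (by norm_num)
  have hb₁' : ContDiffAt ℝ 1 b₁ 0 := hb₁.contDiffAt hU1
  have hb₀' : ContDiffAt ℝ 1 b₀ 0 := hb₀.contDiffAt hU1
  obtain ⟨ψ, hψ, hψ0⟩ := exists_contDiffAt_root hk1 hb₁' hb₀' hb₁0
  obtain ⟨c, hc, hkc⟩ := ContDiff.exists_sub_eq_mul (n := 3) (f := k)
    (by convert hk using 1; norm_num)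
  have hc1 : ContDiff ℝ 1 c := hc.of_le (by norm_num)
  have hψe : ∀ᶠ t in 𝓝 (0 : ℝ), ContDiffAt ℝ 1 ψ t := hψ.eventually (by simp)
  have hb₁e : ∀ᶠ t in 𝓝 (0 : ℝ), ContDiffAt ℝ 1 b₁ t := hb₁'.eventually (by simp)
  obtain ⟨δ, hδ, hψδ⟩ : ∃ δ > 0, ContDiffOn ℝ 1 ψ (Ioo (-δ) δ) := by
    obtain ⟨δ, hδ, hball⟩ := Metric.eventually_nhds_iff_ball.1 hψe
    exact ⟨δ, hδ, fun t ht =>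
      (hball t (by simpa [Real.ball_eq_Ioo] using ht)).contDiffWithinAt⟩
  have hfst : Tendsto Prod.fst (𝓝 (0 : ℝ × ℝ)) (𝓝 (0 : ℝ)) := continuous_fst.tendsto _
  have hshift : Tendsto (fun x : ℝ × ℝ => (x.1, x.2 + x.1 ^ 3 * ψ x.1)) (𝓝 0) (𝓝 0) := by
    have : ContinuousAt (fun x : ℝ × ℝ => (x.1, x.2 + x.1 ^ 3 * ψ x.1)) 0 := by
      have : ContinuousAt (fun x : ℝ × ℝ => ψ x.1) 0 :=
        ContinuousAt.comp (f := Prod.fst) hψ.continuousAt continuousAt_fst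
      fun_prop
    simpa [ContinuousAt, ← Prod.zero_eq_mk] using this
  have hW := (hfst.eventually hψe).and <| (hfst.eventually hb₁e).and <|
    (hfst.eventually hψ0).and (hshift.eventually hφk)
  have hψW (x : ℝ × ℝ) (hx : ContDiffAt ℝ 1 ψ x.1) : ContDiffAt ℝ 1 (fun x : ℝ × ℝ => ψ x.1) x :=
    hx.comp x contDiffAt_fst
  have hB (x : ℝ × ℝ) (hx : ContDiffAt ℝ 1 ψ x.1) :
      ContDiffAt ℝ 1 (fun x : ℝ × ℝ => k (x.1, x.2 + x.1 ^ 3 * ψ x.1)) x := by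
    have := hψW x hx
    exact hk1.contDiffAt.comp x (by fun_prop)
  refine ⟨δ, hδ, ψ, hψδ,
    fun x => k (x.1, x.2 + x.1 ^ 3 * ψ x.1),
    fun x => b₁ x.1 + 3 * (x.2 * ψ x.1 + ψ x.1 ^ 2 * x.1 ^ 3) * k (x.1, x.2 + x.1 ^ 3 * ψ x.1) +
      x.1 ^ 6 * ψ x.1 ^ 3 * c (x.1, x.1 ^ 3 * ψ x.1, x.2 + x.1 ^ 3 * ψ x.1),
    _, hW, fun x hx => (hB x hx.1).contDiffWithinAt, fun x hx => ?_, ?_, ?_, fun x hx => ?_⟩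
  · obtain ⟨hψx, hb₁x, -⟩ := hx
    have h1 := hψW x hψx
    have h2 := hB x hψx
    have h3 : ContDiffAt ℝ 1 (fun x : ℝ × ℝ => b₁ x.1) x := hb₁x.comp x contDiffAt_fst
    have h4 : ContDiffAt ℝ 1 (fun x : ℝ × ℝ =>
        c (x.1, x.1 ^ 3 * ψ x.1, x.2 + x.1 ^ 3 * ψ x.1)) x :=
      hc1.contDiffAt.comp x (by fun_prop)
    exact ContDiffAt.contDiffWithinAt (by fun_prop)
  · simpa using hk0
  · simpa using hb₁0
  · obtain ⟨-, -, hroot, hx⟩ := hx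
    have h := hkc x.1 (x.1 ^ 3 * ψ x.1) (x.2 + x.1 ^ 3 * ψ x.1)
    rw [hx]
    simp only
    linear_combination x.1 ^ 6 * hroot + x.1 ^ 9 * ψ x.1 ^ 3 * h
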